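/- arXiv:2210.14206 — 2 statements merged into one kernel-verified Lean document; each statement's English description precedes it below -/
import Mathlib

section
/- For integers n, k with 1 <= k < n, the numbers of flattened {1}-insertion parking functions satisfy the recurrence f({1}; n+1, k) = k * f({1}; n, k) + (n-1) * f({1}; n-1, k-1) + f_{n, k-1}, where f_{n,j} is the number of flattened permutations of [n] with j runs. -/
namespace FlatPF

/-- Decomposition of a word into maximal weakly increasing runs. -/
def runs : List ℕ → List (List ℕ)
  | [] => []
  | a :: l =>
    match runs l with
    | [] => [[a]]
    | [] :: rs => [a] :: rs
    | (b :: t) :: rs => if a ≤ b then (a :: b :: t) :: rs else [a] :: (b :: t) :: rs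

/-- The number of maximal weakly increasing runs of a word. -/
def numRuns (w : List ℕ) : ℕ := (runs w).length

/-- A word is flattened if the leading values of its runs are weakly increasing. -/
def IsFlattened (w : List ℕ) : Prop :=
  List.Chain' (· ≤ ·) ((runs w).map (fun r => r.headD 0))

/-- A word is a parking function: entries in `[m]` and the weakly increasing
rearrangement `(a'_1, …, a'_m)` satisfies `a'_i ≤ i`. -/
def IsPF (w : List ℕ) : Prop :=
  (∀ x ∈ w, 1 ≤ x ∧ x ≤ w.length) ∧
  ∀ i < w.length, (w.mergeSort (· ≤ ·)).getD i 0 ≤ i + 1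

/-- `w` is obtained by inserting the elements of the multiset `S` into some
permutation of `[n]`, keeping the letters of the permutation in relative order. -/
def IsInsertion (S : Multiset ℕ) (n : ℕ) (w : List ℕ) : Prop :=
  (↑w : Multiset ℕ) = ↑(List.range' 1 n) + S ∧
  ∃ p : List ℕ, p.Perm (List.range' 1 n) ∧ p.Sublist w

/-- Flattened `S`-insertion parking functions of order `n`. -/
def flatIns (S : Multiset ℕ) (n : ℕ) : Set (List ℕ) :=
  {w | IsInsertion S n w ∧ IsFlattened w}

/-- Flattened `S`-insertion parking functions of order `n` with exactly `k` runs. -/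
def flatInsK (S : Multiset ℕ) (n k : ℕ) : Set (List ℕ) :=
  {w | IsInsertion S n w ∧ IsFlattened w ∧ numRuns w = k}

/-- `f(S; n, k)`, the number of flattened `S`-insertion parking functions of order `n`
with exactly `k` runs.  In particular `fS 0 n k` is the number of flattened
permutations of `[n]` with `k` runs. -/
noncomputable def fS (S : Multiset ℕ) (n k : ℕ) : ℕ := (flatInsK S n k).ncard

end FlatPF

namespace FlatPF

open Finset

theorem runs_of_pairwise {a : ℕ} {R : List ℕ} (h : (a :: R).Pairwise (· ≤ ·)) :
    runs (a :: R) = [a :: R] := by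
  induction R generalizing a with
  | nil => rfl
  | cons b R ih =>
    have hab : a ≤ b := List.rel_of_pairwise_cons h (by simp)
    rw [runs, ih h.of_cons]
    simp [hab]

theorem exists_runs_cons (a : ℕ) (t : List ℕ) :
    ∃ R rs, runs (a :: t) = (a :: R) :: rs := by
  rw [runs]
  split
  · exact ⟨_, _, rfl⟩
  · exact ⟨_, _, rfl⟩
  · split
    · exact ⟨_, _, rfl⟩
    · exact ⟨_, _, rfl⟩

theorem flatten_runs (w : List ℕ) : (runs w).flatten = w := by
  induction w with
  | nil => rfl
  | cons a t ih =>
    rw [runs]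
    split
    · simp_all
    · simp_all
    · split <;> simp_all

theorem runs_append {a b : ℕ} {R s : List ℕ} (h : (a :: R).Pairwise (· ≤ ·))
    (hb : ∃ x ∈ a :: R, b < x) :
    runs (a :: R ++ b :: s) = (a :: R) :: runs (b :: s) := by
  induction R generalizing a with
  | nil =>
    have hba : b < a := by simpa using hb
    obtain ⟨R', rs, hr⟩ := exists_runs_cons b s
    change runs (a :: b :: s) = _
    rw [runs, hr]
    simp [hba]
  | cons c R ih =>
    have hac : a ≤ c := List.rel_of_pairwise_cons h (by simp)
    have hb' : ∃ x ∈ c :: R, b < x := by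
      obtain ⟨x, hx, hbx⟩ := hb
      rcases List.mem_cons.1 hx with rfl | hx
      · exact ⟨c, by simp, by omega⟩
      · exact ⟨x, hx, hbx⟩
    change runs (a :: (c :: R ++ b :: s)) = _
    rw [runs, ih h.of_cons hb']
    simp [hac]

theorem exists_first_run (a : ℕ) (t : List ℕ) (h : ¬ (a :: t).Pairwise (· ≤ ·)) :
    ∃ R b s, t = R ++ b :: s ∧ (a :: R).Pairwise (· ≤ ·) ∧ ∃ x ∈ a :: R, b < x := by
  induction t generalizing a with
  | nil => simp at h
  | cons c t ih =>
    by_cases hac : a ≤ c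
    · have h' : ¬ (c :: t).Pairwise (· ≤ ·) := by
        intro h'
        refine h (List.pairwise_cons.2 ⟨fun x hx => ?_, h'⟩)
        rcases List.mem_cons.1 hx with rfl | hx
        · exact hac
        · exact hac.trans (List.rel_of_pairwise_cons h' hx)
      obtain ⟨R, b, s, rfl, hR, x, hx, hbx⟩ := ih c h'
      refine ⟨c :: R, b, s, rfl, List.pairwise_cons.2 ⟨fun y hy => ?_, hR⟩, x, by simp_all, hbx⟩
      rcases List.mem_cons.1 hy with rfl | hy
      · exact hac
      · exact hac.trans (List.rel_of_pairwise_cons hR hy)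
    · exact ⟨[], c, t, rfl, by simp, a, by simp, by omega⟩

theorem isFlattened_of_pairwise {a : ℕ} {R : List ℕ} (h : (a :: R).Pairwise (· ≤ ·)) :
    IsFlattened (a :: R) := by
  rw [IsFlattened, runs_of_pairwise h]
  exact List.isChain_singleton _

theorem numRuns_of_pairwise {a : ℕ} {R : List ℕ} (h : (a :: R).Pairwise (· ≤ ·)) :
    numRuns (a :: R) = 1 := by
  simp [numRuns, runs_of_pairwise h]

theorem isFlattened_append_iff {a b : ℕ} {R s : List ℕ} (h : (a :: R).Pairwise (· ≤ ·))
    (hb : ∃ x ∈ a :: R, b < x) :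
    IsFlattened (a :: R ++ b :: s) ↔ a ≤ b ∧ IsFlattened (b :: s) := by
  obtain ⟨R', rs, hr⟩ := exists_runs_cons b s
  rw [IsFlattened, runs_append h hb, IsFlattened, hr]
  exact List.isChain_cons_cons

theorem numRuns_append {a b : ℕ} {R s : List ℕ} (h : (a :: R).Pairwise (· ≤ ·))
    (hb : ∃ x ∈ a :: R, b < x) :
    numRuns (a :: R ++ b :: s) = numRuns (b :: s) + 1 := by
  rw [numRuns, runs_append h hb, List.length_cons, numRuns]

theorem numRuns_cons_pos (a : ℕ) (t : List ℕ) : 0 < numRuns (a :: t) := by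
  obtain ⟨R, rs, h⟩ := exists_runs_cons a t
  simp [numRuns, h]

theorem IsFlattened.head_le {a : ℕ} {t : List ℕ} (h : IsFlattened (a :: t)) :
    ∀ x ∈ a :: t, a ≤ x := by
  by_cases hp : (a :: t).Pairwise (· ≤ ·)
  · intro x hx
    rcases List.mem_cons.1 hx with rfl | hx
    · exact le_rfl
    · exact List.rel_of_pairwise_cons hp hx
  · obtain ⟨R, b, s, rfl, hR, hb⟩ := exists_first_run a t hp
    obtain ⟨hab, hf⟩ := (isFlattened_append_iff hR hb).1 h
    intro x hx
    rw [← List.cons_append, List.mem_append, List.mem_cons] at hx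
    rcases hx with (rfl | hx) | hx
    · exact le_rfl
    · exact List.rel_of_pairwise_cons hR hx
    · exact hab.trans (hf.head_le x hx)
termination_by t.length
decreasing_by grind

/-- The number of flattened words with `k` runs consisting of a given smallest letter followed by
an arrangement of `n` further letters, computed by splitting off the first run: the `c + 1` letters
outside it form any subset other than the set of the `c + 1` largest letters. -/
def runCount : ℕ → ℕ → ℕ
  | 0, _ => 0
  | k + 1, n => (if k = 0 then 1 else 0) +
      ∑ c ∈ range n, (n.choose (c + 1) - 1) * runCount k c

theorem runCount_succ_eq_add (k n : ℕ) :
    runCount (k + 1) (n + 1) =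
      runCount (k + 1) n + ∑ c ∈ range n, n.choose c * runCount k c := by
  simp only [runCount, sum_range_succ, Nat.choose_self, Nat.sub_self, zero_mul, add_zero,
    add_assoc, ← sum_add_distrib]
  congr 1
  refine sum_congr rfl fun c hc => ?_
  have h : 0 < n.choose (c + 1) := Nat.choose_pos (mem_range.1 hc)
  rw [Nat.choose_succ_succ', ← add_mul]
  congr 1
  omega

theorem sum_choose_mul_pred (k m : ℕ) :
    ∑ c ∈ range m, ((m + 1).choose (c + 1) - 1) * (c * runCount k (c - 1)) +
      ∑ c ∈ range (m + 1), runCount (k + 1) c = (m + 1) * runCount (k + 1) m := by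
  induction m with
  | zero => simp
  | succ m ih =>
    have key : ∑ c ∈ range (m + 1), (m + 1).choose c * (c * runCount k (c - 1)) =
        (m + 1) * ∑ c ∈ range m, m.choose c * runCount k c := by
      rw [sum_range_succ', mul_sum]
      simp only [zero_mul, mul_zero, add_zero, Nat.add_sub_cancel]
      refine sum_congr rfl fun c _ => ?_
      rw [← mul_assoc, ← mul_assoc, Nat.add_one_mul_choose_eq]
    have split : ∑ c ∈ range (m + 1), ((m + 2).choose (c + 1) - 1) * (c * runCount k (c - 1)) =
        ∑ c ∈ range (m + 1), (m + 1).choose c * (c * runCount k (c - 1)) +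
        ∑ c ∈ range m, ((m + 1).choose (c + 1) - 1) * (c * runCount k (c - 1)) := by
      have h0 : ∑ c ∈ range m, ((m + 1).choose (c + 1) - 1) * (c * runCount k (c - 1)) =
          ∑ c ∈ range (m + 1), ((m + 1).choose (c + 1) - 1) * (c * runCount k (c - 1)) := by
        simp [sum_range_succ]
      rw [h0, ← sum_add_distrib]
      refine sum_congr rfl fun c hc => ?_
      have h : 0 < (m + 1).choose (c + 1) := Nat.choose_pos (by have := mem_range.1 hc; omega)
      rw [Nat.choose_succ_succ', ← add_mul]
      congr 1
      omega
    rw [split, key, sum_range_succ _ (m + 1)]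
    have := runCount_succ_eq_add k m
    generalize ∑ c ∈ range m, m.choose c * runCount k c = X at *
    rw [this]
    linarith

theorem runCount_recurrence (k n : ℕ) :
    runCount (k + 1) (n + 1) =
      (k + 1) * runCount (k + 1) n + n * runCount k (n - 1) := by
  induction k generalizing n with
  | zero => simp [runCount]
  | succ k ih =>
    rw [runCount_succ_eq_add]
    suffices h : ∑ c ∈ range n, n.choose c * runCount (k + 1) c =
        (k + 1) * runCount (k + 2) n + n * runCount (k + 1) (n - 1) by
      rw [h]; ring
    cases n with
    | zero => simp [runCount]
    | succ m =>
      have hE : (k + 1) * runCount (k + 2) (m + 1) +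
          (k + 1) * ∑ c ∈ range m, runCount (k + 1) c =
          (k + 1) * ∑ c ∈ range m, (m + 1).choose (c + 1) * runCount (k + 1) c := by
        rw [← mul_add, runCount]
        simp only [sum_range_succ, Nat.choose_self, Nat.sub_self, zero_mul, add_zero,
          Nat.add_one_ne_zero, if_false, zero_add, ← sum_add_distrib]
        congr 1
        refine sum_congr rfl fun c hc => ?_
        have h : 0 < (m + 1).choose (c + 1) :=
          Nat.choose_pos (by have := mem_range.1 hc; omega)
        obtain ⟨d, hd⟩ := Nat.exists_eq_add_of_lt h
        rw [hd]; simp; ring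
      have hS := sum_choose_mul_pred k m
      have hP : ∑ c ∈ range (m + 1), runCount (k + 1) c =
          (k + 1) * ∑ c ∈ range m, runCount (k + 1) c +
            ∑ c ∈ range m, c * runCount k (c - 1) + runCount (k + 1) 0 := by
        rw [sum_range_succ', mul_sum, ← sum_add_distrib]
        simp only [ih]
      have hT : ∑ c ∈ range m, ((m + 1).choose (c + 1) - 1) * (c * runCount k (c - 1)) +
          ∑ c ∈ range m, c * runCount k (c - 1) =
          ∑ c ∈ range m, (m + 1).choose (c + 1) * (c * runCount k (c - 1)) := by
        rw [← sum_add_distrib]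
        refine sum_congr rfl fun c hc => ?_
        have h : 0 < (m + 1).choose (c + 1) :=
          Nat.choose_pos (by have := mem_range.1 hc; omega)
        obtain ⟨d, hd⟩ := Nat.exists_eq_add_of_lt h
        rw [hd]; simp; ring
      have hL : ∑ c ∈ range (m + 1), (m + 1).choose c * runCount (k + 1) c =
          (k + 1) * ∑ c ∈ range m, (m + 1).choose (c + 1) * runCount (k + 1) c +
          ∑ c ∈ range m, (m + 1).choose (c + 1) * (c * runCount k (c - 1)) +
          runCount (k + 1) 0 := by
        rw [sum_range_succ', mul_sum, ← sum_add_distrib]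
        simp only [Nat.choose_zero_right, one_mul]
        congr 1
        refine sum_congr rfl fun c _ => ?_
        rw [ih]; ring
      rw [hL, Nat.add_sub_cancel]
      linarith

open Classical in
/-- The flattened words with `k` runs whose letters are exactly the elements of `B`. -/
noncomputable def flatPerms (B : Finset ℕ) (k : ℕ) : Finset (List ℕ) :=
  {u ∈ B.val.lists.toFinset | IsFlattened u ∧ numRuns u = k}

open Classical in
/-- The arrangements `t` of the elements of `A` for which `a :: t` is flattened with `k` runs. -/
noncomputable def flatTails (a : ℕ) (A : Finset ℕ) (k : ℕ) : Finset (List ℕ) :=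
  {t ∈ A.val.lists.toFinset | IsFlattened (a :: t) ∧ numRuns (a :: t) = k}

theorem mem_flatPerms {B : Finset ℕ} {k : ℕ} {u : List ℕ} :
    u ∈ flatPerms B k ↔ (u : Multiset ℕ) = B.val ∧ IsFlattened u ∧ numRuns u = k := by
  simp [flatPerms, Multiset.mem_lists_iff, eq_comm]

theorem mem_flatTails {a : ℕ} {A : Finset ℕ} {k : ℕ} {t : List ℕ} :
    t ∈ flatTails a A k ↔
      (t : Multiset ℕ) = A.val ∧ IsFlattened (a :: t) ∧ numRuns (a :: t) = k := by
  simp [flatTails, Multiset.mem_lists_iff, eq_comm]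

theorem mem_iff_of_coe_eq_val {B : Finset ℕ} {u : List ℕ} (h : (u : Multiset ℕ) = B.val) (x : ℕ) :
    x ∈ u ↔ x ∈ B := by
  rw [← mem_val, ← h, Multiset.mem_coe]

theorem toFinset_of_coe_eq_val {B : Finset ℕ} {u : List ℕ} (h : (u : Multiset ℕ) = B.val) :
    u.toFinset = B := by
  ext x
  rw [List.mem_toFinset, mem_iff_of_coe_eq_val h]

theorem card_flatPerms {B : Finset ℕ} (hB : B.Nonempty) (k : ℕ) :
    #(flatPerms B k) = #(flatTails (B.min' hB) (B.erase (B.min' hB)) k) := by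
  have hval : B.val = B.min' hB ::ₘ (B.erase (B.min' hB)).val := by
    rw [erase_val, Multiset.cons_erase (B.min'_mem hB)]
  symm
  refine card_bij (fun t _ => B.min' hB :: t) (fun t ht => ?_) (fun t _ t' _ h => ?_)
    (fun u hu => ?_)
  · rw [mem_flatTails] at ht
    rw [mem_flatPerms, hval, ← ht.1]
    exact ⟨rfl, ht.2⟩
  · simpa using h
  · rw [mem_flatPerms] at hu
    obtain ⟨hu, hf, hk⟩ := hu
    cases u with
    | nil =>
      obtain ⟨x, hx⟩ := hB
      exact absurd ((mem_iff_of_coe_eq_val hu x).2 hx) (by simp)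
    | cons b s =>
      have hb : b = B.min' hB := by
        refine le_antisymm (hf.head_le _ ((mem_iff_of_coe_eq_val hu _).2 (B.min'_mem hB)))
          (B.min'_le _ ((mem_iff_of_coe_eq_val hu _).1 (by simp)))
      subst hb
      refine ⟨s, ?_, rfl⟩
      rw [mem_flatTails]
      refine ⟨?_, hf, hk⟩
      rw [hval, ← Multiset.cons_coe] at hu
      exact (Multiset.cons_inj_right _).1 hu

theorem card_not_pairwise_flatTails {a : ℕ} {A : Finset ℕ} (ha : ∀ x ∈ A, a ≤ x) (k : ℕ) :
    #{t ∈ flatTails a A (k + 1) | ¬ (a :: t).Pairwise (· ≤ ·)} =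
      ∑ B ∈ A.powerset with ∃ x ∈ A \ B, ∃ y ∈ B, y < x, #(flatPerms B k) := by
  rw [← card_sigma]
  symm
  have key : ∀ p ∈ ({B ∈ A.powerset | ∃ x ∈ A \ B, ∃ y ∈ B, y < x}).sigma (flatPerms · k),
      (a :: (A \ p.1).sort).Pairwise (· ≤ ·) ∧
      ∃ b s, p.2 = b :: s ∧ a ≤ b ∧ ∃ x ∈ (A \ p.1).sort, b < x := by
    rintro ⟨B, u⟩ hp
    simp only [mem_sigma, mem_filter, mem_powerset, mem_flatPerms] at hp ⊢
    obtain ⟨⟨hBA, x, hx, y, hy, hyx⟩, hu, hf, hk⟩ := hp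
    refine ⟨List.pairwise_cons.2 ⟨fun z hz => ha z ?_, pairwise_sort _ _⟩, ?_⟩
    · exact (mem_sdiff.1 ((mem_sort _).1 hz)).1
    · have hyu := (mem_iff_of_coe_eq_val hu y).2 hy
      cases u with
      | nil => simp at hyu
      | cons b s =>
        refine ⟨b, s, rfl, ha b (hBA ((mem_iff_of_coe_eq_val hu b).1 (by simp))), x,
          (mem_sort _).2 hx, (hf.head_le y hyu).trans_lt hyx⟩
  refine card_bij (fun p _ => (A \ p.1).sort ++ p.2) (fun p hp => ?_) (fun p hp q hq h => ?_)
    (fun t ht => ?_)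
  · obtain ⟨hs, b, s, hbs, hab, x, hx, hbx⟩ := key p hp
    obtain ⟨B, u⟩ := p
    simp only [mem_sigma, mem_filter, mem_powerset, mem_flatPerms, mem_flatTails] at *
    obtain ⟨⟨hBA, -⟩, hu, hf, hk⟩ := hp
    subst hbs
    have hx' : ∃ x ∈ a :: (A \ B).sort, b < x := ⟨x, by simp_all, hbx⟩
    refine ⟨⟨?_, (isFlattened_append_iff hs hx').2 ⟨hab, hf⟩, ?_⟩, fun hp => ?_⟩
    · rw [← Multiset.coe_add, hu, sort_eq, sdiff_val, tsub_add_cancel_of_le (val_le_iff.2 hBA)]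
    · rw [← hk]; exact numRuns_append hs hx'
    · exact absurd ((List.pairwise_append.1 hp.of_cons).2.2 x hx b (by simp)) (by omega)
  · have tail_eq : ∀ p ∈ ({B ∈ A.powerset | ∃ x ∈ A \ B, ∃ y ∈ B, y < x}).sigma (flatPerms · k),
        p.2 = (runs (a :: ((A \ p.1).sort ++ p.2))).tail.flatten ∧ p.1 = p.2.toFinset := by
      intro p hp
      obtain ⟨hs, b, s, hbs, hab, x, hx, hbx⟩ := key p hp
      refine ⟨?_, ?_⟩
      · rw [hbs, ← List.cons_append, runs_append hs ⟨x, by simp_all, hbx⟩, List.tail_cons,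
          flatten_runs]
      · simp only [mem_sigma, mem_flatPerms] at hp
        exact (toFinset_of_coe_eq_val hp.2.1).symm
    have h2 : p.2 = q.2 := by rw [(tail_eq p hp).1, (tail_eq q hq).1, h]
    have h1 : p.1 = q.1 := by rw [(tail_eq p hp).2, (tail_eq q hq).2, h2]
    exact Sigma.ext h1 (heq_of_eq h2)
  · simp only [mem_filter, mem_flatTails] at ht
    obtain ⟨⟨ht, hf, hk⟩, hp⟩ := ht
    obtain ⟨R, b, s, rfl, hR, hb⟩ := exists_first_run a t hp
    obtain ⟨hab, hf'⟩ := (isFlattened_append_iff hR hb).1 hf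
    have hk' := (numRuns_append hR hb).symm.trans hk
    have hnd : (R ++ b :: s).Nodup := by
      rw [← Multiset.coe_nodup, ht]; exact A.nodup
    obtain ⟨hnR, hns, hdis⟩ := List.nodup_append.1 hnd
    have hmem := mem_iff_of_coe_eq_val ht
    have hsub : (b :: s).toFinset ⊆ A := fun x hx =>
      (hmem x).1 (List.mem_append_right _ (List.mem_toFinset.1 hx))
    have hsd : A \ (b :: s).toFinset = R.toFinset := by
      ext x
      rw [mem_sdiff, List.mem_toFinset, List.mem_toFinset, ← hmem, List.mem_append]
      exact ⟨fun h => h.1.resolve_right h.2, fun h => ⟨.inl h, fun h' => hdis x h x h' rfl⟩⟩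
    have hsort : (A \ (b :: s).toFinset).sort = R := by
      rw [hsd]
      refine List.Perm.eq_of_pairwise (fun x y _ _ => le_antisymm) (pairwise_sort _ _) hR.of_cons ?_
      rw [← Multiset.coe_eq_coe, sort_eq, List.toFinset_val, hnR.dedup]
    refine ⟨⟨(b :: s).toFinset, b :: s⟩, ?_, by simp only [hsort]⟩
    simp only [mem_sigma, mem_filter, mem_powerset, mem_flatPerms]
    refine ⟨⟨hsub, ?_⟩, ?_, hf', by omega⟩
    · obtain ⟨x, hx, hbx⟩ := hb
      rcases List.mem_cons.1 hx with rfl | hx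
      · omega
      · exact ⟨x, by rw [hsd]; simpa using hx, b, by simp, hbx⟩
    · rw [List.toFinset_val, hns.dedup]

theorem card_pairwise_flatTails {a : ℕ} {A : Finset ℕ} (ha : ∀ x ∈ A, a ≤ x) (k : ℕ) :
    #{t ∈ flatTails a A (k + 1) | (a :: t).Pairwise (· ≤ ·)} = if k = 0 then 1 else 0 := by
  have hs : (a :: A.sort).Pairwise (· ≤ ·) :=
    List.pairwise_cons.2 ⟨fun x hx => ha x ((mem_sort _).1 hx), pairwise_sort _ _⟩
  split_ifs with hk
  · rw [card_eq_one]
    refine ⟨A.sort, ?_⟩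
    ext t
    simp only [mem_filter, mem_flatTails, mem_singleton]
    refine ⟨fun ⟨⟨ht, _⟩, hp⟩ => ?_, ?_⟩
    · refine List.Perm.eq_of_pairwise (fun x y _ _ => le_antisymm) hp.of_cons (pairwise_sort _ _) ?_
      rw [← Multiset.coe_eq_coe, sort_eq, ht]
    · rintro rfl
      exact ⟨⟨sort_eq _ _, isFlattened_of_pairwise hs, by rw [numRuns_of_pairwise hs, hk]⟩, hs⟩
  · rw [card_eq_zero, filter_eq_empty_iff]
    intro t ht hp
    have := (mem_flatTails.1 ht).2.2
    rw [numRuns_of_pairwise hp] at this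
    omega

/-- Every finite set of naturals has exactly one final segment of each size. -/
theorem card_final_segments (A : Finset ℕ) (c : ℕ) (hc : c ≤ #A) :
    #{B ∈ A.powersetCard c | ¬ ∃ x ∈ A \ B, ∃ y ∈ B, y < x} = 1 := by
  rw [card_eq_one]
  induction A using Finset.induction_on_min generalizing c with
  | empty =>
    obtain rfl : c = 0 := by simpa using hc
    exact ⟨∅, by ext; simp⟩
  | insert a A ha ih =>
    have haA : a ∉ A := fun h => lt_irrefl _ (ha a h)
    rw [card_insert_of_notMem haA] at hc
    rcases hc.eq_or_lt with rfl | hc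
    · refine ⟨insert a A, ?_⟩
      rw [← card_insert_of_notMem haA, powersetCard_self]
      ext B
      simp only [mem_filter, mem_singleton]
      exact ⟨fun h => h.1, by rintro rfl; simp⟩
    · obtain ⟨C, hC⟩ := ih c (by omega)
      refine ⟨C, ?_⟩
      rw [← hC]
      ext B
      simp only [mem_filter, mem_powersetCard]
      constructor
      · rintro ⟨⟨hB, hcard⟩, hno⟩
        have haB : a ∉ B := by
          intro haB
          have : B = insert a A := by
            refine hB.antisymm fun x hx => ?_
            by_contra hxB
            have hxA : x ∈ A := by
              rcases mem_insert.1 hx with rfl | h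
              · exact absurd haB hxB
              · exact h
            exact hno ⟨x, mem_sdiff.2 ⟨hx, hxB⟩, a, haB, ha x hxA⟩
          rw [this, card_insert_of_notMem haA] at hcard
          omega
        refine ⟨⟨(subset_insert_iff_of_notMem haB).1 hB, hcard⟩, ?_⟩
        rintro ⟨x, hx, y, hy, h⟩
        rw [mem_sdiff] at hx
        exact hno ⟨x, mem_sdiff.2 ⟨mem_insert_of_mem hx.1, hx.2⟩, y, hy, h⟩
      · rintro ⟨⟨hB, hcard⟩, hno⟩
        refine ⟨⟨hB.trans (subset_insert _ _), hcard⟩, ?_⟩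
        rintro ⟨x, hx, y, hy, h⟩
        rw [mem_sdiff, mem_insert] at hx
        rcases hx.1 with rfl | hxA
        · exact absurd (ha y (hB hy)) (by omega)
        · exact hno ⟨x, mem_sdiff.2 ⟨hxA, hx.2⟩, y, hy, h⟩

theorem card_nonfinal_subsets (A : Finset ℕ) (c : ℕ) (hc : c ≤ #A) :
    #{B ∈ A.powersetCard c | ∃ x ∈ A \ B, ∃ y ∈ B, y < x} = (#A).choose c - 1 := by
  have h := card_filter_add_card_filter_not (s := A.powersetCard c)
    (fun B => ∃ x ∈ A \ B, ∃ y ∈ B, y < x)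
  rw [card_final_segments A c hc, card_powersetCard] at h
  omega

theorem card_flatTails {a : ℕ} {A : Finset ℕ} (ha : ∀ x ∈ A, a ≤ x) (k : ℕ) :
    #(flatTails a A k) = runCount k #A := by
  induction k generalizing a A with
  | zero =>
    rw [runCount, card_eq_zero, eq_empty_iff_forall_notMem]
    intro t ht
    have := (mem_flatTails.1 ht).2.2
    have := numRuns_cons_pos a t
    omega
  | succ k ih =>
    rw [← card_filter_add_card_filter_not (fun t => (a :: t).Pairwise (· ≤ ·)),
      card_pairwise_flatTails ha, card_not_pairwise_flatTails ha, runCount]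
    congr 1
    have hB : ∀ B ∈ ({B ∈ A.powerset | ∃ x ∈ A \ B, ∃ y ∈ B, y < x} : Finset _),
        #B - 1 ∈ range #A ∧ B.Nonempty ∧ #(flatPerms B k) = runCount k (#B - 1) := by
      intro B hB
      simp only [mem_filter, mem_powerset] at hB
      obtain ⟨hBA, x, hx, y, hy, -⟩ := hB
      have hne : B.Nonempty := ⟨y, hy⟩
      have hle := card_le_card hBA
      have hpos := hne.card_pos
      refine ⟨mem_range.2 (by omega), hne, ?_⟩
      rw [card_flatPerms hne, ih fun z hz => B.min'_le _ (mem_of_mem_erase hz),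
        card_erase_of_mem (B.min'_mem hne)]
    rw [← sum_fiberwise_of_maps_to (fun B h => (hB B h).1)]
    refine sum_congr rfl fun c hc => ?_
    rw [← card_nonfinal_subsets A (c + 1) (mem_range.1 hc), ← smul_eq_mul, ← sum_const]
    have hset : ({B ∈ {B ∈ A.powerset | ∃ x ∈ A \ B, ∃ y ∈ B, y < x} | #B - 1 = c} : Finset _) =
        {B ∈ A.powersetCard (c + 1) | ∃ x ∈ A \ B, ∃ y ∈ B, y < x} := by
      ext B
      simp only [mem_filter, mem_powerset, mem_powersetCard]
      constructor
      · rintro ⟨⟨hBA, hno⟩, hcard⟩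
        have := (hB B (by simp only [mem_filter, mem_powerset]; exact ⟨hBA, hno⟩)).2.1.card_pos
        exact ⟨⟨hBA, by omega⟩, hno⟩
      · rintro ⟨⟨hBA, hcard⟩, hno⟩
        exact ⟨⟨hBA, hno⟩, by omega⟩
    rw [← hset]
    refine sum_congr rfl fun B h => ?_
    obtain ⟨h', rfl⟩ := mem_filter.1 h
    exact (hB B h').2.2

theorem fS_eq_runCount {S : Multiset ℕ} {n : ℕ} {A : Finset ℕ}
    (hA : ∀ x ∈ A, 1 ≤ x) (hS : (↑(List.range' 1 n) : Multiset ℕ) + S = 1 ::ₘ A.val)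
    (hsub : ∀ t : List ℕ, (t : Multiset ℕ) = A.val →
      ∃ p : List ℕ, p.Perm (List.range' 1 n) ∧ p.Sublist (1 :: t)) (k : ℕ) :
    fS S n k = runCount k #A := by
  have himage : flatInsK S n k = List.cons 1 '' (flatTails 1 A k : Set (List ℕ)) := by
    ext w
    simp only [flatInsK, IsInsertion, hS, Set.mem_ofPred_eq, Set.mem_image, mem_coe, mem_flatTails]
    constructor
    · rintro ⟨⟨hw, -⟩, hf, hk⟩
      have hmem : ∀ x, x ∈ w ↔ x = 1 ∨ x ∈ A := fun x => by
        rw [← Multiset.mem_coe, hw, Multiset.mem_cons, mem_val]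
      cases w with
      | nil => simpa using (hmem 1).2 (.inl rfl)
      | cons b t =>
        obtain rfl : b = 1 := by
          refine le_antisymm (hf.head_le _ ((hmem 1).2 (.inl rfl))) ?_
          rcases (hmem b).1 (by simp) with rfl | h
          · exact le_rfl
          · exact hA b h
        rw [← Multiset.cons_coe, Multiset.cons_inj_right] at hw
        exact ⟨t, ⟨hw, hf, hk⟩, rfl⟩
    · rintro ⟨t, ⟨ht, hf, hk⟩, rfl⟩
      exact ⟨⟨by rw [← Multiset.cons_coe, ht], hsub t ht⟩, hf, hk⟩
  rw [fS, himage, Set.ncard_image_of_injective _ List.cons_injective, Set.ncard_coe_finset,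
    card_flatTails hA]

theorem fS_singleton_one (n k : ℕ) : fS {1} n k = runCount k n := by
  have hval : (List.range' 1 n).toFinset.val = ↑(List.range' 1 n) := by
    rw [List.toFinset_val, List.Nodup.dedup List.nodup_range']
  have hcard : #(List.range' 1 n).toFinset = n := by
    rw [List.toFinset_card_of_nodup List.nodup_range', List.length_range']
  refine (fS_eq_runCount (A := (List.range' 1 n).toFinset)
    (fun x hx => ?_) ?_ (fun t ht => ?_) k).trans (by rw [hcard])
  · rw [List.mem_toFinset, List.mem_range'_1] at hx
    exact hx.1
  · rw [hval, add_comm, Multiset.singleton_add]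
  · exact ⟨t, Multiset.coe_eq_coe.1 (ht.trans hval), List.sublist_cons_self _ _⟩

theorem fS_zero_succ (n k : ℕ) : fS 0 (n + 1) k = runCount k n := by
  have hval : (List.range' 2 n).toFinset.val = ↑(List.range' 2 n) := by
    rw [List.toFinset_val, List.Nodup.dedup List.nodup_range']
  have hcard : #(List.range' 2 n).toFinset = n := by
    rw [List.toFinset_card_of_nodup List.nodup_range', List.length_range']
  refine (fS_eq_runCount (A := (List.range' 2 n).toFinset)
    (fun x hx => ?_) ?_ (fun t ht => ?_) k).trans (by rw [hcard])
  · rw [List.mem_toFinset, List.mem_range'_1] at hx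
    omega
  · rw [hval, add_zero, List.range'_succ, Multiset.cons_coe]
  · refine ⟨1 :: t, ?_, List.Sublist.refl _⟩
    rw [List.range'_succ]
    exact (Multiset.coe_eq_coe.1 (ht.trans hval)).cons 1

end FlatPF

open FlatPF in
/-- For `1 ≤ k < n`,
`f({1}; n+1, k) = k·f({1}; n, k) + (n-1)·f({1}; n-1, k-1) + f_{n,k-1}`. -/
theorem stmt11 (n k : ℕ) (hk : 1 ≤ k) (hkn : k < n) :
    fS {1} (n + 1) k =
      k * fS {1} n k + (n - 1) * fS {1} (n - 1) (k - 1) + fS 0 n (k - 1) := by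
  obtain ⟨j, rfl⟩ := Nat.exists_eq_add_of_le' hk
  obtain ⟨m, rfl⟩ := Nat.exists_eq_add_of_le' (hk.trans hkn.le)
  rw [fS_singleton_one, fS_singleton_one, fS_singleton_one, fS_zero_succ, runCount_recurrence]
  simp only [Nat.add_sub_cancel]
  ring
end

section
/- For integers n, k, r with 1 <= k < n and r >= 1, the numbers f(1_r; n, k) satisfy the recurrence f(1_r; n+1, k) = k * f(1_r; n, k) + (n-1) * f(1_r; n-1, k-1) + r * f(1_{r-1}; n, k-1). -/
namespace FlatPF

/-- The descent bottoms of the word `p :: l`, in order. -/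
def descentBottoms : ℕ → List ℕ → List ℕ
  | _, [] => []
  | p, a :: l => if p ≤ a then descentBottoms a l else a :: descentBottoms a l

/-- Every descent bottom of `p :: l` is at most all the letters to its right. -/
def BottomsMinimal : ℕ → List ℕ → Prop
  | _, [] => True
  | p, a :: l => (a < p → ∀ x ∈ l, a ≤ x) ∧ BottomsMinimal a l

theorem exists_runs_cons_s18 (a : ℕ) (l : List ℕ) :
    ∃ t rs, runs (a :: l) = (a :: t) :: rs ∧
      rs.map (fun r => r.headD 0) = descentBottoms a l := by
  induction l generalizing a with
  | nil => exact ⟨[], [], rfl, rfl⟩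
  | cons b l ih =>
    obtain ⟨t, rs, h, h'⟩ := ih b
    by_cases hab : a ≤ b
    · refine ⟨b :: t, rs, ?_, ?_⟩
      · rw [runs, h]; simp [hab]
      · simpa [descentBottoms, hab] using h'
    · refine ⟨[], (b :: t) :: rs, ?_, ?_⟩
      · rw [runs, h]; simp [hab]
      · simpa [descentBottoms, hab] using h'

theorem numRuns_cons (a : ℕ) (l : List ℕ) :
    numRuns (a :: l) = (descentBottoms a l).length + 1 := by
  obtain ⟨t, rs, h, h'⟩ := exists_runs_cons_s18 a l
  rw [numRuns, h, ← h']; simp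

theorem isChain_cons_descentBottoms (c a : ℕ) (l : List ℕ) (hca : c ≤ a) :
    List.IsChain (· ≤ ·) (c :: descentBottoms a l) ↔
      (∀ x ∈ l, c ≤ x) ∧ BottomsMinimal a l := by
  induction l generalizing a c with
  | nil => simp [descentBottoms, BottomsMinimal]
  | cons b l ih =>
    by_cases hab : a ≤ b
    · simp only [descentBottoms, hab, if_true, BottomsMinimal, ih c b (hca.trans hab),
        List.forall_mem_cons, hca.trans hab, not_lt.2 hab, false_imp_iff, true_and]
    · simp only [descentBottoms, hab, if_false, BottomsMinimal, List.isChain_cons_cons,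
        ih b b le_rfl, List.forall_mem_cons, not_le.1 hab, true_imp_iff]
      constructor
      · rintro ⟨h1, h2, h3⟩
        exact ⟨⟨h1, fun x hx => h1.trans (h2 x hx)⟩, h2, h3⟩
      · rintro ⟨⟨h1, -⟩, h2, h3⟩
        exact ⟨h1, h2, h3⟩

theorem isFlattened_cons (a : ℕ) (l : List ℕ) :
    IsFlattened (a :: l) ↔ (∀ x ∈ l, a ≤ x) ∧ BottomsMinimal a l := by
  obtain ⟨t, rs, h, h'⟩ := exists_runs_cons_s18 a l
  rw [IsFlattened, h, List.map_cons, h', ← isChain_cons_descentBottoms a a l le_rfl]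
  rfl

theorem descentBottoms_map {f : ℕ → ℕ} (hf : StrictMono f) (p : ℕ) (l : List ℕ) :
    descentBottoms (f p) (l.map f) = (descentBottoms p l).map f := by
  induction l generalizing p with
  | nil => rfl
  | cons a l ih =>
    simp only [List.map_cons, descentBottoms, hf.le_iff_le, ih]
    split_ifs <;> simp

theorem bottomsMinimal_map {f : ℕ → ℕ} (hf : StrictMono f) (p : ℕ) (l : List ℕ) :
    BottomsMinimal (f p) (l.map f) ↔ BottomsMinimal p l := by
  induction l generalizing p with
  | nil => rfl
  | cons a l ih =>
    simp [BottomsMinimal, hf.lt_iff_lt, hf.le_iff_le, ih]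

/-- The last letter of `u` (or `p`, if `u` is empty) is at most the first letter of `v`. -/
def IsAscent (p : ℕ) (u v : List ℕ) : Prop :=
  ∃ b ∈ v.head?, u.getLastD p ≤ b

theorem bottomsMinimal_append_cons_of_lt {N p : ℕ} {u v : List ℕ} (hp : p ≤ N)
    (hu : ∀ x ∈ u, x < N) (hv : ∀ x ∈ v, x < N) :
    BottomsMinimal p (u ++ N :: v) ↔
      BottomsMinimal p (u ++ v) ∧ ∀ b ∈ v.head?, ∀ x ∈ v, b ≤ x := by
  induction u generalizing p with
  | nil =>
    cases v with
    | nil => simp [BottomsMinimal]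
    | cons b v =>
      have hb : b < N := hv b (by simp)
      simp [BottomsMinimal, hb, not_lt.2 hp]
      tauto
  | cons a u ih =>
    have ha : a < N := hu a (by simp)
    simp only [List.cons_append, BottomsMinimal,
      ih ha.le (fun x hx => hu x (List.mem_cons_of_mem _ hx))]
    simp only [List.mem_append, List.mem_cons]
    constructor
    · rintro ⟨h1, h2, h3⟩
      exact ⟨⟨fun h x hx => h1 h x (by tauto), h2⟩, h3⟩
    · rintro ⟨⟨h1, h2⟩, h3⟩
      refine ⟨fun h x hx => ?_, h2, h3⟩
      rcases hx with hx | rfl | hx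
      · exact h1 h x (.inl hx)
      · exact ha.le
      · exact h1 h x (.inr hx)

open Classical in
theorem length_descentBottoms_append_cons_of_lt {N p : ℕ} {u v : List ℕ} (hp : p ≤ N)
    (hu : ∀ x ∈ u, x < N) (hv : ∀ x ∈ v, x < N) :
    (descentBottoms p (u ++ N :: v)).length =
      (descentBottoms p (u ++ v)).length + if IsAscent p u v then 1 else 0 := by
  induction u generalizing p with
  | nil =>
    cases v with
    | nil => simp [descentBottoms, hp, IsAscent]
    | cons b v =>
      have hb : b < N := hv b (by simp)
      by_cases hpb : p ≤ b <;> simp [descentBottoms, hp, not_le.2 hb, hpb, IsAscent]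
  | cons a u ih =>
    have ha : a < N := hu a (by simp)
    have := ih ha.le (fun x hx => hu x (List.mem_cons_of_mem _ hx))
    have e : IsAscent p (a :: u) v ↔ IsAscent a u v := by
      simp only [IsAscent, List.getLastD_cons]
    simp only [List.cons_append, descentBottoms, e]
    split_ifs at this ⊢ <;> simp [this]

theorem head_le_of_not_isAscent {p : ℕ} {u v : List ℕ} (h : BottomsMinimal p (u ++ v))
    (ha : ¬ IsAscent p u v) : ∀ b ∈ v.head?, ∀ x ∈ v, b ≤ x := by
  induction u generalizing p with
  | nil =>
    cases v with
    | nil => simp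
    | cons b v =>
      simp only [IsAscent, List.head?_cons, Option.mem_some_iff, exists_eq_left',
        List.getLastD_nil, not_le] at ha
      simpa using h.1 ha
  | cons a u ih =>
    refine ih h.2 ?_
    simpa only [IsAscent, List.getLastD_cons] using ha

theorem getLastD_mem_cons (a : ℕ) (u : List ℕ) : u.getLastD a ∈ a :: u := by
  induction u generalizing a with
  | nil => simp
  | cons b u ih => rw [List.getLastD_cons]; exact List.mem_cons_of_mem _ (ih b)

theorem bottomsMinimal_append_cons_of_between {b p : ℕ} {u v : List ℕ}
    (hu : u.getLastD p ≤ b) (hv : ∀ x ∈ v, b ≤ x) :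
    BottomsMinimal p (u ++ b :: v) ↔ BottomsMinimal p (u ++ v) := by
  induction u generalizing p with
  | nil =>
    simp only [List.getLastD_nil] at hu
    cases v with
    | nil => simp [BottomsMinimal]
    | cons c v =>
      have hc : b ≤ c := hv c (by simp)
      simp [BottomsMinimal, not_lt.2 hu, not_lt.2 hc, not_lt.2 (hu.trans hc)]
  | cons a u ih =>
    rw [List.getLastD_cons] at hu
    simp only [List.cons_append, BottomsMinimal, ih hu]
    refine and_congr_left fun _ => imp_congr_right fun _ => ?_
    simp only [List.mem_append, List.mem_cons]
    constructor
    · exact fun h x hx => h x (by tauto)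
    · rintro h x (hx | rfl | hx)
      · exact h x (.inl hx)
      · refine le_trans ?_ hu
        rcases List.mem_cons.1 (getLastD_mem_cons a u) with h' | h'
        · exact h'.ge
        · exact h _ (.inl h')
      · exact h x (.inr hx)

theorem descentBottoms_append_cons_of_between {b p : ℕ} {u v : List ℕ}
    (hu : u.getLastD p ≤ b) (hv : ∀ x ∈ v, b ≤ x) :
    (descentBottoms p (u ++ b :: v)) = (descentBottoms p (u ++ v)) := by
  induction u generalizing p with
  | nil =>
    simp only [List.getLastD_nil] at hu
    cases v with
    | nil => simp [descentBottoms, hu]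
    | cons c v =>
      have hc : b ≤ c := hv c (by simp)
      simp [descentBottoms, hu, hc, hu.trans hc]
  | cons a u ih =>
    rw [List.getLastD_cons] at hu
    simp only [List.cons_append, descentBottoms, ih hu]

/-- All ways to write a word as a concatenation of two words. -/
def splits : List ℕ → List (List ℕ × List ℕ)
  | [] => [([], [])]
  | a :: l => ([], a :: l) :: (splits l).map (fun q => (a :: q.1, q.2))

theorem mem_splits {w : List ℕ} {q : List ℕ × List ℕ} : q ∈ splits w ↔ q.1 ++ q.2 = w := by
  obtain ⟨u, v⟩ := q
  induction w generalizing u v with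
  | nil => simp [splits]
  | cons a l ih =>
    cases u with
    | nil => simp [splits]
    | cons c u =>
      simp only [splits, List.mem_cons, Prod.mk.injEq, reduceCtorEq, false_and, false_or,
        List.mem_map, Prod.exists, ih, List.cons_append, List.cons.injEq]
      constructor
      · rintro ⟨u', v', h, ⟨h1, rfl⟩, rfl⟩; exact ⟨h1.symm, h⟩
      · rintro ⟨rfl, h⟩; exact ⟨u, v, h, ⟨rfl, rfl⟩, rfl⟩

theorem nodup_splits (w : List ℕ) : (splits w).Nodup := by
  induction w with
  | nil => simp [splits]
  | cons a l ih =>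
    refine List.nodup_cons.2 ⟨by simp, ih.map ?_⟩
    rintro ⟨u, v⟩ ⟨u', v'⟩ h
    simpa using h

open Classical in
theorem countP_splits_not_isAscent (p : ℕ) (w : List ℕ) :
    (splits w).countP (fun q => ¬ IsAscent p q.1 q.2) = (descentBottoms p w).length + 1 := by
  induction w generalizing p with
  | nil => simp [splits, IsAscent, descentBottoms]
  | cons a l ih =>
    have := ih a
    simp only [splits, List.countP_cons, List.countP_map, descentBottoms]
    have e : ∀ u v, IsAscent p (a :: u) v ↔ IsAscent a u v := by
      intro u v; simp only [IsAscent, List.getLastD_cons]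
    have e' : IsAscent p [] (a :: l) ↔ p ≤ a := by simp [IsAscent]
    simp only [Function.comp_def, e, this, e']
    by_cases h : p ≤ a <;> simp [h]

open Classical in
theorem countP_splits_between_of_forall_le (b p : ℕ) (w : List ℕ) (hw : ∀ x ∈ w, b ≤ x) :
    (splits w).countP (fun q => q.1.getLastD p ≤ b ∧ ∀ x ∈ q.2, b ≤ x) =
      w.count b + if p ≤ b then 1 else 0 := by
  induction w generalizing p with
  | nil => by_cases h : p ≤ b <;> simp [splits, h]
  | cons a l ih =>
    have hl : ∀ x ∈ l, b ≤ x := fun x hx => hw x (List.mem_cons_of_mem _ hx)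
    have := ih a hl
    simp only [splits, List.countP_cons, List.countP_map, Function.comp_def,
      List.getLastD_cons, this, List.getLastD_nil, List.count_cons]
    have hab : a ≤ b ↔ a = b := ⟨fun h => le_antisymm h (hw a (by simp)), fun h => h.le⟩
    have hpb : (p ≤ b ∧ ∀ x ∈ a :: l, b ≤ x) ↔ p ≤ b := and_iff_left hw
    simp only [hab, hpb, beq_iff_eq, decide_eq_true_eq]

open Classical in
theorem countP_splits_between_of_notMem (b p : ℕ) (w : List ℕ) (hp : p ≤ b) (hw : b ∉ w) :
    (splits w).countP (fun q => q.1.getLastD p ≤ b ∧ ∀ x ∈ q.2, b ≤ x) = 1 := by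
  by_cases h : ∀ x ∈ w, b ≤ x
  · rw [countP_splits_between_of_forall_le b p w h, List.count_eq_zero_of_not_mem hw, if_pos hp]
  clear hp
  induction w generalizing p with
  | nil => simp at h
  | cons a l ih =>
    simp only [splits, List.countP_cons, List.countP_map, Function.comp_def,
      List.getLastD_cons, List.getLastD_nil, h, and_false, decide_false]
    have hl : b ∉ l := fun hx => hw (List.mem_cons_of_mem _ hx)
    by_cases h' : ∀ x ∈ l, b ≤ x
    · have hab : a ≤ b := by
        by_contra hab
        exact h (List.forall_mem_cons.2 ⟨(not_le.1 hab).le, h'⟩)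
      rw [countP_splits_between_of_forall_le b a l h', List.count_eq_zero_of_not_mem hl]
      simp [hab]
    · simpa using ih a hl h'

open Classical in
/-- The pairs of words whose concatenation lies in `T`. -/
noncomputable def cuts (T : Finset (List ℕ)) : Finset (List ℕ × List ℕ) :=
  T.biUnion fun w => (splits w).toFinset

theorem mem_cuts {T : Finset (List ℕ)} {q : List ℕ × List ℕ} :
    q ∈ cuts T ↔ q.1 ++ q.2 ∈ T := by
  simp [cuts, mem_splits]

theorem card_filter_cuts (T : Finset (List ℕ)) (P : List ℕ × List ℕ → Prop)
    [DecidablePred P] :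
    ((cuts T).filter P).card = ∑ w ∈ T, (splits w).countP (fun q => P q) := by
  classical
  rw [cuts, Finset.filter_biUnion, Finset.card_biUnion]
  · refine Finset.sum_congr rfl fun w _ => ?_
    have : (splits w).toFinset.filter P = ((splits w).filter fun q => P q).toFinset := by
      ext q; simp
    rw [this, List.toFinset_card_of_nodup ((nodup_splits w).filter _),
      List.countP_eq_length_filter]
  · intro w _ w' _ hne
    refine Finset.disjoint_left.2 fun q hq hq' => hne ?_
    simp only [Finset.mem_filter, List.mem_toFinset, mem_splits] at hq hq'
    exact hq.1.symm.trans hq'.1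

open Classical in
/-- The words `w` with letters `M` for which `1 :: w` is flattened and has `k` runs,
provided that all letters are positive. -/
noncomputable def words (M : Multiset ℕ) (k : ℕ) : Finset (List ℕ) :=
  M.lists.toFinset.filter fun w =>
    BottomsMinimal 1 w ∧ (descentBottoms 1 w).length + 1 = k

theorem mem_words {M : Multiset ℕ} {k : ℕ} {w : List ℕ} :
    w ∈ words M k ↔ (w : Multiset ℕ) = M ∧
      BottomsMinimal 1 w ∧ (descentBottoms 1 w).length + 1 = k := by
  simp [words, Multiset.mem_lists_iff, eq_comm (a := M)]

theorem card_words_map {f : ℕ → ℕ} (hf : StrictMono f) (hf1 : f 1 = 1)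
    (M : Multiset ℕ) (k : ℕ) : (words (M.map f) k).card = (words M k).card := by
  symm
  refine Finset.card_bij (fun w _ => w.map f) ?_ ?_ ?_
  · intro w hw
    rw [mem_words] at hw ⊢
    obtain ⟨rfl, h1, h2⟩ := hw
    have hG := bottomsMinimal_map hf 1 w
    have hD := descentBottoms_map hf 1 w
    rw [hf1] at hG hD
    exact ⟨rfl, hG.2 h1, by rw [hD, List.length_map, h2]⟩
  · intro w _ w' _ h
    exact hf.injective.list_map h
  · intro w hw
    rw [mem_words] at hw
    obtain ⟨h0, h1, h2⟩ := hw
    obtain ⟨w', rfl⟩ : ∃ w' : List ℕ, w'.map f = w := by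
      have : ∀ x ∈ w, ∃ y, f y = x := by
        intro x hx
        have : x ∈ M.map f := by rw [← h0]; exact hx
        obtain ⟨y, -, hy⟩ := Multiset.mem_map.1 this
        exact ⟨y, hy⟩
      exact (Set.range_list_map f).ge this
    have hG := bottomsMinimal_map hf 1 w'
    have hD := descentBottoms_map hf 1 w'
    rw [hf1] at hG hD
    refine ⟨w', ?_, rfl⟩
    rw [mem_words]
    refine ⟨Multiset.map_injective hf.injective (by simpa using h0), hG.1 h1, ?_⟩
    rw [hD, List.length_map] at h2
    exact h2

open Classical in
theorem card_words_cons_of_lt {N : ℕ} {M : Multiset ℕ} (k : ℕ) (h1 : 1 ≤ N)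
    (hN : ∀ x ∈ M, x < N) :
    (words (N ::ₘ M) k).card =
      ((cuts (words M k)).filter fun q => ¬ IsAscent 1 q.1 q.2).card +
      ((cuts (words M (k - 1))).filter fun q => IsAscent 1 q.1 q.2 ∧
        ∀ b ∈ q.2.head?, ∀ x ∈ q.2, b ≤ x).card := by
  have hlt : ∀ u v : List ℕ, (↑(u ++ v) : Multiset ℕ) = M →
      (∀ x ∈ u, x < N) ∧ ∀ x ∈ v, x < N := by
    intro u v h
    refine ⟨fun x hx => hN x ?_, fun x hx => hN x ?_⟩ <;> rw [← h] <;> simp [hx]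
  rw [← Finset.card_union_of_disjoint]
  · symm
    refine Finset.card_bij (fun q _ => q.1 ++ N :: q.2) ?_ ?_ ?_
    · rintro ⟨u, v⟩ hq
      simp only [Finset.mem_union, Finset.mem_filter, mem_cuts, mem_words] at hq ⊢
      have hM : (↑(u ++ v) : Multiset ℕ) = M := by tauto
      obtain ⟨hu, hv⟩ := hlt u v hM
      rw [bottomsMinimal_append_cons_of_lt h1 hu hv,
        length_descentBottoms_append_cons_of_lt h1 hu hv]
      refine ⟨?_, ?_⟩
      · rw [← hM, Multiset.cons_coe, Multiset.coe_eq_coe]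
        exact List.perm_middle
      · rcases hq with ⟨⟨-, hG, hD⟩, ha⟩ | ⟨⟨-, hG, hD⟩, ha, hb⟩
        · exact ⟨⟨hG, head_le_of_not_isAscent hG ha⟩, by simp [ha, hD]⟩
        · exact ⟨⟨hG, hb⟩, by simp only [ha, if_true]; omega⟩
    · rintro ⟨u, v⟩ hq ⟨u', v'⟩ hq' h
      simp only [Finset.mem_union, Finset.mem_filter, mem_cuts, mem_words] at hq hq' h
      have hM : (↑(u ++ v) : Multiset ℕ) = M := by tauto
      have hM' : (↑(u' ++ v') : Multiset ℕ) = M := by tauto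
      obtain ⟨hu, hv⟩ := hlt u v hM
      obtain ⟨hu', hv'⟩ := hlt u' v' hM'
      have := (List.append_cons_inj_of_notMem (fun hx => (hu' N hx).false)
        (fun hx => (hv' N hx).false)).1 h.symm
      simp [this]
    · intro w hw
      rw [mem_words] at hw
      obtain ⟨hM, hG, hD⟩ := hw
      have hNw : N ∈ w := by
        rw [← Multiset.mem_coe, hM]; exact Multiset.mem_cons_self _ _
      obtain ⟨u, v, rfl⟩ := List.append_of_mem hNw
      have hM' : (↑(u ++ v) : Multiset ℕ) = M := by
        rw [← Multiset.cons_inj_right N, ← hM, Multiset.cons_coe, Multiset.coe_eq_coe]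
        exact List.perm_middle.symm
      obtain ⟨hu, hv⟩ := hlt u v hM'
      rw [bottomsMinimal_append_cons_of_lt h1 hu hv] at hG
      rw [length_descentBottoms_append_cons_of_lt h1 hu hv] at hD
      refine ⟨(u, v), ?_, rfl⟩
      simp only [Finset.mem_union, Finset.mem_filter, mem_cuts, mem_words]
      by_cases ha : IsAscent 1 u v
      · right
        simp only [ha, if_true] at hD
        exact ⟨⟨hM', hG.1, by omega⟩, ha, hG.2⟩
      · left
        simp only [ha, if_false] at hD
        exact ⟨⟨hM', hG.1, hD⟩, ha⟩
  · refine Finset.disjoint_left.2 fun q hq hq' => ?_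
    rw [Finset.mem_filter] at hq hq'
    exact hq.2 hq'.2.1

open Classical in
theorem card_filter_cuts_isAscent (M : Multiset ℕ) (k : ℕ) :
    ((cuts (words M k)).filter fun q => IsAscent 1 q.1 q.2 ∧
        ∀ b ∈ q.2.head?, ∀ x ∈ q.2, b ≤ x).card =
      ∑ b ∈ M.toFinset, ((cuts (words (M.erase b) k)).filter fun q =>
        q.1.getLastD 1 ≤ b ∧ ∀ x ∈ q.2, b ≤ x).card := by
  rw [← Finset.card_sigma]
  symm
  refine Finset.card_bij (fun s _ => (s.2.1, s.1 :: s.2.2)) ?_ ?_ ?_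
  · rintro ⟨b, u, v⟩ hq
    simp only [Finset.mem_sigma, Multiset.mem_toFinset, Finset.mem_filter, mem_cuts,
      mem_words] at hq ⊢
    obtain ⟨hb, ⟨hM, hG, hD⟩, hu, hv⟩ := hq
    rw [bottomsMinimal_append_cons_of_between hu hv, descentBottoms_append_cons_of_between hu hv]
    refine ⟨⟨?_, hG, hD⟩, ⟨b, rfl, hu⟩, ?_⟩
    · rw [← Multiset.cons_erase hb, ← hM, Multiset.cons_coe, Multiset.coe_eq_coe]
      exact List.perm_middle
    · simpa using hv
  · rintro ⟨b, u, v⟩ _ ⟨b', u', v'⟩ _ h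
    simp only [Prod.mk.injEq, List.cons.injEq] at h
    obtain ⟨rfl, rfl, rfl⟩ := h
    rfl
  · rintro ⟨u, v⟩ hq
    simp only [Finset.mem_filter, mem_cuts, mem_words] at hq
    obtain ⟨⟨hM, hG, hD⟩, ⟨b, hb, hu⟩, hv⟩ := hq
    obtain ⟨v, rfl⟩ : ∃ v', v = b :: v' := ⟨v.tail, (List.cons_head?_tail hb).symm⟩
    have hv' : ∀ x ∈ v, b ≤ x := by simpa using hv
    rw [bottomsMinimal_append_cons_of_between hu hv'] at hG
    rw [descentBottoms_append_cons_of_between hu hv'] at hD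
    have hM' : b ::ₘ (↑(u ++ v) : Multiset ℕ) = M := by
      rw [← hM, Multiset.cons_coe, Multiset.coe_eq_coe]
      exact List.perm_middle.symm
    refine ⟨⟨b, u, v⟩, ?_, rfl⟩
    simp only [Finset.mem_sigma, Multiset.mem_toFinset, Finset.mem_filter, mem_cuts, mem_words]
    rw [← hM', Multiset.erase_cons_head]
    exact ⟨Multiset.mem_cons_self _ _, ⟨rfl, hG, hD⟩, hu, hv'⟩

/-- The letters `2, …, n` together with `r` ones. -/
def letters (r n : ℕ) : Multiset ℕ := Multiset.replicate r 1 + (Finset.Icc 2 n).val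

theorem mem_letters {r n x : ℕ} : x ∈ letters r n ↔ (r ≠ 0 ∧ x = 1) ∨ (2 ≤ x ∧ x ≤ n) := by
  rw [letters, Multiset.mem_add, Multiset.mem_replicate, Finset.mem_val, Finset.mem_Icc]

theorem letters_succ {n : ℕ} (r : ℕ) (hn : 1 ≤ n) :
    letters r (n + 1) = (n + 1) ::ₘ letters r n := by
  rw [letters, letters, ← Multiset.add_cons, ← Finset.insert_Icc_right_eq_Icc_add_one (by omega),
    Finset.insert_val_of_notMem (by simp)]

theorem letters_erase_one {r : ℕ} (n : ℕ) (hr : 1 ≤ r) :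
    (letters r n).erase 1 = letters (r - 1) n := by
  obtain ⟨r, rfl⟩ := Nat.exists_eq_add_of_le' hr
  simp [letters, Multiset.replicate_succ]

theorem letters_erase_of_mem_Icc {b n : ℕ} (r : ℕ) (hb : b ∈ Finset.Icc 2 n) :
    (letters r n).erase b =
      (letters r (n - 1)).map fun x => if x < b then x else x + 1 := by
  have hb' := Finset.mem_Icc.1 hb
  have h1 : (if 1 < b then 1 else 1 + 1) = 1 := if_pos (by omega)
  rw [letters, letters, Multiset.erase_add_right_pos _ hb, Multiset.map_add,
    Multiset.map_replicate, h1]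
  congr 1
  rw [← Finset.erase_val]
  have hinj : Function.Injective fun x => if x < b then x else x + 1 := by
    intro x y h
    grind
  have : (Finset.Icc 2 n).erase b = (Finset.Icc 2 (n - 1)).map ⟨_, hinj⟩ := by
    ext x
    simp only [Finset.mem_erase, Finset.mem_Icc, Finset.mem_map, Function.Embedding.coeFn_mk]
    constructor
    · intro h
      by_cases hx : x < b
      · exact ⟨x, by omega, if_pos hx⟩
      · exact ⟨x - 1, by omega, by rw [if_neg (by omega)]; omega⟩
    · rintro ⟨y, hy, rfl⟩
      split_ifs <;> omega
  rw [this, Finset.map_val]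
  rfl

theorem card_words_letters_succ (n k r : ℕ) (hn : 1 ≤ n) (hr : 1 ≤ r) :
    (words (letters r (n + 1)) k).card =
      k * (words (letters r n) k).card +
      (n - 1) * (words (letters r (n - 1)) (k - 1)).card +
      r * (words (letters (r - 1) n) (k - 1)).card := by
  classical
  have hlt : ∀ x ∈ letters r n, x < n + 1 := by
    intro x hx
    rw [mem_letters] at hx
    omega
  rw [letters_succ r hn, card_words_cons_of_lt k (by omega) hlt, add_assoc]
  congr 1
  · rw [card_filter_cuts, mul_comm, ← smul_eq_mul]
    refine Finset.sum_eq_card_nsmul fun w hw => ?_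
    rw [countP_splits_not_isAscent]
    exact (mem_words.1 hw).2.2
  · have hM : (letters r n).toFinset = insert 1 (Finset.Icc 2 n) := by
      ext x
      rw [Multiset.mem_toFinset, mem_letters, Finset.mem_insert, Finset.mem_Icc]
      omega
    rw [card_filter_cuts_isAscent, hM, Finset.sum_insert (by simp), add_comm]
    congr 1
    · have hc : (Finset.Icc 2 n).card = n - 1 := by simp
      rw [← smul_eq_mul]
      conv_rhs => arg 1; rw [← hc]
      refine Finset.sum_eq_card_nsmul fun b hb => ?_
      have hb' := Finset.mem_Icc.1 hb
      have hmono : StrictMono fun x => if x < b then x else x + 1 := by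
        intro x y h
        grind
      have hcard := card_words_map hmono (if_pos (by omega)) (letters r (n - 1)) (k - 1)
      rw [← letters_erase_of_mem_Icc r hb] at hcard
      rw [card_filter_cuts, ← hcard, Finset.card_eq_sum_ones]
      refine Finset.sum_congr rfl fun w hw => ?_
      refine countP_splits_between_of_notMem b 1 w (by omega) fun hbw => ?_
      rw [← Multiset.mem_coe, (mem_words.1 hw).1, letters_erase_of_mem_Icc r hb,
        Multiset.mem_map] at hbw
      obtain ⟨x, -, hx⟩ := hbw
      grind
    · rw [letters_erase_one n hr, card_filter_cuts, mul_comm, ← smul_eq_mul]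
      refine Finset.sum_eq_card_nsmul fun w hw => ?_
      have hw' := (mem_words.1 hw).1
      rw [countP_splits_between_of_forall_le, ← Multiset.coe_count, hw', letters,
        Multiset.count_add, Multiset.count_replicate_self, Multiset.count_eq_zero_of_notMem]
      · simp; omega
      · simp
      · intro x hx
        rw [← Multiset.mem_coe, hw', mem_letters] at hx
        omega

theorem isInsertion_iff {r n : ℕ} {w : List ℕ} (hn : 1 ≤ n) :
    IsInsertion (Multiset.replicate r 1) n w ↔ (w : Multiset ℕ) = 1 ::ₘ letters r n := by
  have h : (↑(List.range' 1 n) : Multiset ℕ) + Multiset.replicate r 1 = 1 ::ₘ letters r n := by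
    have h' : (↑(List.range' 1 n) : Multiset ℕ) = 1 ::ₘ (Finset.Icc 2 n).val := by
      obtain ⟨n, rfl⟩ := Nat.exists_eq_add_of_le' hn
      rw [List.range'_succ, ← Multiset.cons_coe]
      congr 1
    rw [h', letters, Multiset.cons_add, add_comm]
  rw [IsInsertion, h, and_iff_left_iff_imp]
  intro hw
  have : List.Subperm (List.range' 1 n) w := by
    rw [← Multiset.coe_le, hw, ← h]
    exact Multiset.le_add_right _ _
  exact this

theorem fS_replicate_one {n : ℕ} (r k : ℕ) (hn : 1 ≤ n) :
    fS (Multiset.replicate r 1) n k = (words (letters r n) k).card := by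
  have hpos : ∀ x ∈ letters r n, 1 ≤ x := by
    intro x hx
    rw [mem_letters] at hx
    omega
  have : flatInsK (Multiset.replicate r 1) n k =
      (fun w : List ℕ => 1 :: w) '' (words (letters r n) k : Set (List ℕ)) := by
    ext w
    simp only [flatInsK, Set.mem_ofPred_eq, Set.mem_image, Finset.mem_coe, mem_words,
      isInsertion_iff hn]
    constructor
    · rintro ⟨hw, hf, hk⟩
      cases w with
      | nil => simp at hw
      | cons a l =>
        rw [isFlattened_cons] at hf
        rw [numRuns_cons] at hk
        have ha : a = 1 := by
          have h1 : 1 ∈ a :: l := by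
            rw [← Multiset.mem_coe, hw]; exact Multiset.mem_cons_self _ _
          have h2 : a ∈ 1 ::ₘ letters r n := by rw [← hw]; simp
          rcases List.mem_cons.1 h1 with h | h
          · exact h.symm
          · rcases Multiset.mem_cons.1 h2 with h' | h'
            · exact h'
            · exact le_antisymm (hf.1 1 h) (hpos a h')
        subst ha
        refine ⟨l, ⟨?_, hf.2, hk⟩, rfl⟩
        rwa [← Multiset.cons_coe, Multiset.cons_inj_right] at hw
    · rintro ⟨l, ⟨hl, hG, hD⟩, rfl⟩
      rw [isFlattened_cons, numRuns_cons, ← Multiset.cons_coe, hl]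
      refine ⟨rfl, ⟨fun x hx => hpos x ?_, hG⟩, hD⟩
      rw [← hl]; exact hx
  rw [fS, this, Set.ncard_image_of_injective _ List.cons_injective, Set.ncard_coe_finset]

end FlatPF

open FlatPF in
/-- For `1 ≤ k < n` and `r ≥ 1`,
`f(1_r; n+1, k) = k f(1_r; n, k) + (n-1) f(1_r; n-1, k-1) + r f(1_{r-1}; n, k-1)`. -/
theorem stmt18 (n k r : ℕ) (hr : 1 ≤ r) (hk : 1 ≤ k) (hkn : k < n) :
    fS (Multiset.replicate r 1) (n + 1) k =
      k * fS (Multiset.replicate r 1) n k +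
      (n - 1) * fS (Multiset.replicate r 1) (n - 1) (k - 1) +
      r * fS (Multiset.replicate (r - 1) 1) n (k - 1) := by
  rw [fS_replicate_one r k (by omega), fS_replicate_one r k (by omega),
    fS_replicate_one r (k - 1) (by omega), fS_replicate_one (r - 1) (k - 1) (by omega)]
  exact card_words_letters_succ n k r (by omega) hr
end
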